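/- Let (X0,Y0) ∈ PPS be strongly efficient with all components positive, and for t ≥ 0 let β(t) = max{β ∈ ℝ : (Ω_t X0, Φ_β Y0) ∈ PPS}. Then there exists t0 > 0 such that the ratio β(t)/t is constant for all t ∈ (0, t0]. -/

import Mathlib

open Finset Set

/-- The production possibility set (variable returns to scale):
`(X, Y) ∈ PPS` iff there are convex weights `lam` with
`Σ_j lam_j X_j ≤ X` and `Y ≤ Σ_j lam_j Y_j` componentwise. -/
def PPS {m s n : ℕ} (X : Fin n → Fin m → ℝ) (Y : Fin n → Fin s → ℝ) :
    Set ((Fin m → ℝ) × (Fin s → ℝ)) :=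
  {p | ∃ lam : Fin n → ℝ, (∀ j, 0 ≤ lam j) ∧ (∑ j, lam j) = 1 ∧
    (∀ i, ∑ j, lam j * X j i ≤ p.1 i) ∧ (∀ r, p.2 r ≤ ∑ j, lam j * Y j r)}

/-- Weak efficiency: no point of PPS strictly dominates in every coordinate. -/
def WeaklyEfficient {m s n : ℕ} (X : Fin n → Fin m → ℝ) (Y : Fin n → Fin s → ℝ)
    (p : (Fin m → ℝ) × (Fin s → ℝ)) : Prop :=
  p ∈ PPS X Y ∧ ¬ ∃ q ∈ PPS X Y, (∀ i, q.1 i < p.1 i) ∧ (∀ r, p.2 r < q.2 r)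

/-- Strong (Pareto) efficiency. -/
def StronglyEfficient {m s n : ℕ} (X : Fin n → Fin m → ℝ) (Y : Fin n → Fin s → ℝ)
    (p : (Fin m → ℝ) × (Fin s → ℝ)) : Prop :=
  p ∈ PPS X Y ∧ ¬ ∃ q ∈ PPS X Y, (∀ i, q.1 i ≤ p.1 i) ∧ (∀ r, p.2 r ≤ q.2 r) ∧ q ≠ p

/-- `(V, U, μ0)` is a supporting hyperplane of PPS at the point `p0`. -/
def SupportingHyperplane {m s n : ℕ} (X : Fin n → Fin m → ℝ) (Y : Fin n → Fin s → ℝ)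
    (p0 : (Fin m → ℝ) × (Fin s → ℝ)) (V : Fin m → ℝ) (U : Fin s → ℝ) (μ0 : ℝ) : Prop :=
  (¬ (V = 0 ∧ U = 0)) ∧
  ((∑ r, U r * p0.2 r) - (∑ i, V i * p0.1 i) + μ0 = 0) ∧
  (∀ p ∈ PPS X Y, (∑ r, U r * p.2 r) - (∑ i, V i * p.1 i) + μ0 ≤ 0)

/-- `Ω_t X0 = ((1 + ω_i t) x_{i0})_i`. -/
noncomputable def scaleX {m : ℕ} (ω : Fin m → ℝ) (t : ℝ) (X0 : Fin m → ℝ) : Fin m → ℝ :=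
  fun i => (1 + ω i * t) * X0 i

/-- `Φ_β Y0 = ((1 + δ_r β) y_{r0})_r`. -/
noncomputable def scaleY {s : ℕ} (δ : Fin s → ℝ) (β : ℝ) (Y0 : Fin s → ℝ) : Fin s → ℝ :=
  fun r => (1 + δ r * β) * Y0 r

/-- `(X0, Y0)` is of the directional smallest scale size:
`(Ω_t X0, Φ_β Y0) ∉ PPS` for every `t < 0` and every `β`. -/
def DSSS {m s n : ℕ} (X : Fin n → Fin m → ℝ) (Y : Fin n → Fin s → ℝ)
    (ω : Fin m → ℝ) (δ : Fin s → ℝ) (X0 : Fin m → ℝ) (Y0 : Fin s → ℝ) : Prop :=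
  ∀ t < (0 : ℝ), ∀ β : ℝ, (scaleX ω t X0, scaleY δ β Y0) ∉ PPS X Y

/-- Feasible region `F` of the fractional program (Model 28): triples `(U, V, μ0)`. -/
def Fset {m s n : ℕ} (X : Fin n → Fin m → ℝ) (Y : Fin n → Fin s → ℝ)
    (X0 : Fin m → ℝ) (Y0 : Fin s → ℝ) : Set ((Fin s → ℝ) × (Fin m → ℝ) × ℝ) :=
  {p | (∀ r, 0 ≤ p.1 r) ∧ (∀ i, 0 ≤ p.2.1 i) ∧
    (∀ j, (∑ r, p.1 r * Y j r) - (∑ i, p.2.1 i * X j i) + p.2.2 ≤ 0) ∧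
    ((∑ r, p.1 r * Y0 r) - (∑ i, p.2.1 i * X0 i) + p.2.2 = 0) ∧
    ((∑ i, p.2.1 i * X0 i) = 1)}

/-- The fractional objective `(Σ_i v_i ω_i x_{i0}) / (Σ_r u_r δ_r y_{r0})` of Model (28). -/
noncomputable def seRatio {m s : ℕ} (ω : Fin m → ℝ) (δ : Fin s → ℝ)
    (X0 : Fin m → ℝ) (Y0 : Fin s → ℝ) (p : (Fin s → ℝ) × (Fin m → ℝ) × ℝ) : ℝ :=
  (∑ i, p.2.1 i * ω i * X0 i) / (∑ r, p.1 r * δ r * Y0 r)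

/-- Feasible region `G` of the linear program (Model 33): tuples `(Γ, Λ, τ, μ0')`. -/
def Gset {m s n : ℕ} (X : Fin n → Fin m → ℝ) (Y : Fin n → Fin s → ℝ)
    (ω : Fin m → ℝ) (δ : Fin s → ℝ) (X0 : Fin m → ℝ) (Y0 : Fin s → ℝ) :
    Set ((Fin m → ℝ) × (Fin s → ℝ) × ℝ × ℝ) :=
  {q | (∀ i, 0 ≤ q.1 i) ∧ (∀ r, 0 ≤ q.2.1 r) ∧ 0 ≤ q.2.2.1 ∧
    (∀ j, (∑ r, q.2.1 r / δ r * Y j r) - (∑ i, q.1 i / ω i * X j i) + q.2.2.2 ≤ 0) ∧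
    ((∑ r, q.2.1 r / δ r * Y0 r) - (∑ i, q.1 i / ω i * X0 i) + q.2.2.2 = 0) ∧
    ((∑ i, q.1 i / ω i * X0 i) = q.2.2.1) ∧
    ((∑ r, q.2.1 r * Y0 r) = 1)}

/-- The upper boundary of a convex planar set lies above each of its chords. -/
theorem chord_le_of_isGreatest {C : Set (ℝ × ℝ)} (hC : Convex ℝ C) {a b c u v w : ℝ}
    (ha : (a, u) ∈ C) (hb : (b, v) ∈ C) (hac : a < c) (hcb : c < b)
    (hw : IsGreatest {y | (c, y) ∈ C} w) :
    (b - c) * u + (c - a) * v ≤ (b - a) * w := by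
  have hab : 0 < b - a := by linarith
  have key : (c, (b - c) / (b - a) * u + (c - a) / (b - a) * v) ∈ C := by
    have h := hC ha hb (a := (b - c) / (b - a)) (b := (c - a) / (b - a))
      (div_nonneg (by linarith) hab.le) (div_nonneg (by linarith) hab.le)
      (by field_simp; ring)
    have hc : (b - c) / (b - a) * a + (c - a) / (b - a) * b = c := by
      field_simp; ring
    simpa [hc] using h
  have h := hw.2 key
  have e : (b - c) * u + (c - a) * v
      = (b - a) * ((b - c) / (b - a) * u + (c - a) / (b - a) * v) := by
    field_simp
  rw [e]
  exact mul_le_mul_of_nonneg_left h hab.le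

/-- If the chord between two points of the upper boundary of a convex planar set extends to the
left inside the set, then the boundary coincides with this chord. -/
theorem eq_chord_of_extends_left {C : Set (ℝ × ℝ)} (hC : Convex ℝ C) {a b t u v w ε : ℝ}
    (hat : a < t) (htb : t < b) (hε : 0 < ε)
    (hu : IsGreatest {y | (a, y) ∈ C} u) (hv : (b, v) ∈ C)
    (hw : IsGreatest {y | (t, y) ∈ C} w)
    (hext : (a - ε * (b - a), u - ε * (v - u)) ∈ C) :
    (b - t) * u + (t - a) * v = (b - a) * w := by
  refine le_antisymm (chord_le_of_isGreatest hC hu.1 hv hat htb hw) ?_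
  have hpos : 0 < ε * (b - a) := mul_pos hε (by linarith)
  have h := chord_le_of_isGreatest hC hext hw.1 (by linarith) hat hu
  refine le_of_mul_le_mul_left ?_ hε
  linarith

/-- Let `f` be the upper boundary of a closed convex planar set, with `f 0 = 0`. If the positive
reals carry finitely many labels such that chords between equally labelled points extend to the
left, then `f t / t` is constant for small `t > 0`. -/
theorem exists_div_const_of_finite_pattern {κ : Type*} [Finite κ] {C : Set (ℝ × ℝ)}
    (hC : Convex ℝ C) (hCc : IsClosed C) {f : ℝ → ℝ}
    (hf : ∀ t, 0 ≤ t → IsGreatest {y | (t, y) ∈ C} (f t)) (hf0 : f 0 = 0)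
    (p : ℝ → κ)
    (hp : ∀ a b, 0 < a → a < b → p a = p b →
      ∃ ε > 0, (a - ε * (b - a), f a - ε * (f b - f a)) ∈ C) :
    ∃ t0 > (0 : ℝ), ∃ c : ℝ, ∀ t ∈ Set.Ioc (0 : ℝ) t0, f t / t = c := by
  obtain ⟨q, hq⟩ := Finite.exists_infinite_fiber fun k : ℕ => p (1 / ((k : ℝ) + 1))
  rw [Set.infinite_coe_iff] at hq
  obtain ⟨N, hN⟩ := hq.nonempty
  have hfreq := Nat.frequently_atTop_iff_infinite.2 hq
  have hlim := tendsto_one_div_add_atTop_nhds_zero_nat (𝕜 := ℝ)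
  have hpos : ∀ k : ℕ, (0 : ℝ) < 1 / ((k : ℝ) + 1) := fun k => by positivity
  set b : ℝ := 1 / ((N : ℝ) + 1) with hb
  have hb0 : 0 < b := hpos N
  have hpb : p b = q := hN
  refine ⟨b, hb0, f b / b, fun t ht => ?_⟩
  obtain ⟨ht0, htb⟩ := ht
  rcases htb.eq_or_lt with rfl | htb
  · rfl
  have hlow := chord_le_of_isGreatest hC (hf 0 le_rfl).1 (hf b hb0.le).1 ht0 htb (hf t ht0.le)
  have hbt : 0 < b - t := by linarith
  let L : ℝ → ℝ := fun x => ((b - x) * f t - (t - x) * f b) / (b - t)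
  have hL : Continuous L := by fun_prop
  have hmem : (0, L 0) ∈ C := by
    have htend : Filter.Tendsto (fun k : ℕ => ((1 / ((k : ℝ) + 1), L (1 / ((k : ℝ) + 1))) : ℝ × ℝ))
        Filter.atTop (nhds (0, L 0)) :=
      hlim.prodMk_nhds ((hL.tendsto 0).comp hlim)
    refine hCc.mem_of_frequently_of_tendsto ?_ htend
    refine (hfreq.and_eventually (hlim.eventually (gt_mem_nhds ht0))).mono ?_
    rintro k ⟨hk, hkt⟩
    have hka := hpos k
    have hpk : p (1 / ((k : ℝ) + 1)) = q := hk
    obtain ⟨ε, hε, hext⟩ := hp _ b hka (hkt.trans htb) (hpk.trans hpb.symm)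
    have hline := eq_chord_of_extends_left hC hkt htb hε (hf _ hka.le) (hf b hb0.le).1
      (hf t ht0.le) hext
    have hval : L (1 / ((k : ℝ) + 1)) = f (1 / ((k : ℝ) + 1)) := by
      rw [div_eq_iff hbt.ne']
      linarith
    rw [hval]
    exact (hf _ hka.le).1
  have hle : L 0 ≤ 0 := ((hf 0 le_rfl).2 hmem).trans_eq hf0
  have hup := (div_le_iff₀ hbt).1 hle
  rw [div_eq_div_iff ht0.ne' hb0.ne']
  rw [hf0] at hlow
  linarith

/-- A finite system of sign constraints persists slightly beyond a point `a`, away from `b`,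
provided that the constraints tight at `a` are tight at `b`. -/
theorem eventually_forall_nonneg_extend {ι : Type*} [Finite ι] {a b : ι → ℝ}
    (ha : ∀ k, 0 ≤ a k) (hab : ∀ k, a k = 0 → b k = 0) :
    ∀ᶠ ε in nhdsWithin (0 : ℝ) (Set.Ioi 0), ∀ k, 0 ≤ a k - ε * (b k - a k) := by
  refine Filter.eventually_all.2 fun k => ?_
  rcases (ha k).eq_or_lt with h | h
  · simp [hab k h.symm, ← h]
  · have hc : Continuous fun ε : ℝ => a k - ε * (b k - a k) := by fun_prop
    have := (hc.tendsto' 0 (a k) (by simp)).eventually (lt_mem_nhds h)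
    exact (this.filter_mono nhdsWithin_le_nhds).mono fun ε => le_of_lt

theorem convex_PPS {m s n : ℕ} (X : Fin n → Fin m → ℝ) (Y : Fin n → Fin s → ℝ) :
    Convex ℝ (PPS X Y) := by
  rintro p ⟨l, hl0, hl1, hlx, hly⟩ q ⟨l', hl0', hl1', hlx', hly'⟩ a b ha hb hab
  have hsum : ∀ z : Fin n → ℝ, ∑ j, (a * l j + b * l' j) * z j
      = a * ∑ j, l j * z j + b * ∑ j, l' j * z j := fun z => by
    simp only [add_mul, Finset.sum_add_distrib, Finset.mul_sum, mul_assoc]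
  refine ⟨fun j => a * l j + b * l' j, fun j => ?_, ?_, fun i => ?_, fun r => ?_⟩
  · have := hl0 j
    have := hl0' j
    positivity
  · rw [Finset.sum_add_distrib, ← Finset.mul_sum, ← Finset.mul_sum, hl1, hl1']
    linarith
  · rw [hsum]
    exact add_le_add (mul_le_mul_of_nonneg_left (hlx i) ha) (mul_le_mul_of_nonneg_left (hlx' i) hb)
  · rw [hsum]
    exact add_le_add (mul_le_mul_of_nonneg_left (hly r) ha) (mul_le_mul_of_nonneg_left (hly' r) hb)

theorem isClosed_PPS {m s n : ℕ} (X : Fin n → Fin m → ℝ) (Y : Fin n → Fin s → ℝ) :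
    IsClosed (PPS X Y) := by
  have hcl : IsClosed {z : stdSimplex ℝ (Fin n) × ((Fin m → ℝ) × (Fin s → ℝ)) |
      (∀ i, ∑ j, z.1.1 j * X j i ≤ z.2.1 i) ∧ (∀ r, z.2.2 r ≤ ∑ j, z.1.1 j * Y j r)} := by
    have hcoe : ∀ j, Continuous
        fun z : stdSimplex ℝ (Fin n) × ((Fin m → ℝ) × (Fin s → ℝ)) => z.1.1 j :=
      fun j => (continuous_apply j).comp (continuous_subtype_val.comp continuous_fst)
    simp only [Set.ofPred_and, Set.ofPred_forall]
    refine (isClosed_iInter fun i => isClosed_le ?_ (by fun_prop)).inter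
      (isClosed_iInter fun r => isClosed_le (by fun_prop) ?_)
    · exact continuous_finsetSum _ fun j _ => (hcoe j).mul continuous_const
    · exact continuous_finsetSum _ fun j _ => (hcoe j).mul continuous_const
  have : CompactSpace (stdSimplex ℝ (Fin n)) :=
    isCompact_iff_compactSpace.1 (isCompact_stdSimplex ℝ (Fin n))
  convert isClosedMap_snd_of_compactSpace _ hcl using 1
  ext p
  constructor
  · rintro ⟨l, h0, h1, hx, hy⟩
    exact ⟨(⟨l, h0, h1⟩, p), ⟨hx, hy⟩, rfl⟩
  · rintro ⟨⟨l, p⟩, ⟨hx, hy⟩, rfl⟩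
    exact ⟨l.1, l.2.1, l.2.2, hx, hy⟩

/-- At a strongly efficient point no output expansion in a nonzero direction is possible. -/
theorem StronglyEfficient.le_zero_of_scaleY_mem {m s n : ℕ} {X : Fin n → Fin m → ℝ}
    {Y : Fin n → Fin s → ℝ} {X0 : Fin m → ℝ} {Y0 δ : Fin s → ℝ}
    (hse : StronglyEfficient X Y (X0, Y0)) (hY0 : ∀ r, 0 < Y0 r) (hδ : ∀ r, 0 ≤ δ r)
    (hδ0 : δ ≠ 0) {β : ℝ} (h : (X0, scaleY δ β Y0) ∈ PPS X Y) : β ≤ 0 := by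
  by_contra! hβ
  refine hse.2 ⟨_, h, fun i => le_rfl, fun r => ?_, fun heq => hδ0 ?_⟩
  · have := mul_nonneg (mul_nonneg (hδ r) hβ.le) (hY0 r).le
    simp only [scaleY]
    linarith
  · funext r
    have hr : (1 + δ r * β) * Y0 r = Y0 r := congrFun (congrArg Prod.snd heq) r
    have hz : δ r * β * Y0 r = 0 := by linarith
    simpa [hβ.ne', (hY0 r).ne'] using hz

/-- Theorem 2: there is t0 > 0 such that β(t)/t is constant on (0, t0]. -/
theorem right_hand_ratio_constant
    {m s n : ℕ} (hm : 1 ≤ m) (hs : 1 ≤ s) (hn : 1 ≤ n)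
    (X : Fin n → Fin m → ℝ) (Y : Fin n → Fin s → ℝ)
    (hX : ∀ j i, 0 < X j i) (hY : ∀ j r, 0 < Y j r)
    (ω : Fin m → ℝ) (δ : Fin s → ℝ)
    (hω : ∀ i, 0 ≤ ω i) (hδ : ∀ r, 0 ≤ δ r)
    (hωsum : (∑ i, ω i) = (m : ℝ)) (hδsum : (∑ r, δ r) = (s : ℝ))
    (X0 : Fin m → ℝ) (Y0 : Fin s → ℝ)
    (hX0 : ∀ i, 0 < X0 i) (hY0 : ∀ r, 0 < Y0 r)
    (hse : StronglyEfficient X Y (X0, Y0))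
    (βf : ℝ → ℝ)
    (hβf : ∀ t : ℝ, 0 ≤ t →
      IsGreatest {β : ℝ | (scaleX ω t X0, scaleY δ β Y0) ∈ PPS X Y} (βf t)) :
    ∃ t0 > (0 : ℝ), ∃ c : ℝ, ∀ t ∈ Set.Ioc (0 : ℝ) t0, βf t / t = c := by
  let C : Set (ℝ × ℝ) := {z | (scaleX ω z.1 X0, scaleY δ z.2 Y0) ∈ PPS X Y}
  have hCc : IsClosed C := by
    refine (isClosed_PPS X Y).preimage ?_
    unfold scaleX scaleY
    fun_prop
  have hC : Convex ℝ C := by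
    intro z hz z' hz' a b ha hb hab
    have h := convex_PPS X Y hz hz' ha hb hab
    have e : (scaleX ω (a • z + b • z').1 X0, scaleY δ (a • z + b • z').2 Y0)
        = a • (scaleX ω z.1 X0, scaleY δ z.2 Y0)
          + b • (scaleX ω z'.1 X0, scaleY δ z'.2 Y0) := by
      obtain rfl : b = 1 - a := by linarith
      ext k <;> simp [scaleX, scaleY] <;> ring
    change (scaleX ω (a • z + b • z').1 X0, scaleY δ (a • z + b • z').2 Y0) ∈ PPS X Y
    rwa [e]
  have hδ0 : δ ≠ 0 := by
    rintro rfl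
    have : (1 : ℝ) ≤ s := by exact_mod_cast hs
    simp only [Pi.zero_apply, Finset.sum_const_zero] at hδsum
    linarith
  have hX00 : scaleX ω 0 X0 = X0 := by ext; simp [scaleX]
  have hY00 : scaleY δ 0 Y0 = Y0 := by ext; simp [scaleY]
  have hf0 : βf 0 = 0 := by
    have h := hβf 0 le_rfl
    rw [hX00] at h
    refine le_antisymm (hse.le_zero_of_scaleY_mem hY0 hδ hδ0 h.1) (h.2 ?_)
    simpa [hY00] using hse.1
  have hsol : ∀ t : ℝ, ∃ l : Fin n → ℝ, 0 ≤ t → (∀ j, 0 ≤ l j) ∧ (∑ j, l j) = 1 ∧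
      (∀ i, ∑ j, l j * X j i ≤ scaleX ω t X0 i) ∧
      (∀ r, scaleY δ (βf t) Y0 r ≤ ∑ j, l j * Y j r) := by
    intro t
    by_cases ht : 0 ≤ t
    · obtain ⟨l, hl⟩ := (hβf t ht).1
      exact ⟨l, fun _ => hl⟩
    · exact ⟨0, fun h => absurd h ht⟩
  choose l hl using hsol
  let slack : ℝ → Fin n ⊕ Fin m ⊕ Fin s → ℝ := fun t =>
    Sum.elim (l t) (Sum.elim (fun i => scaleX ω t X0 i - ∑ j, l t j * X j i)
      (fun r => (∑ j, l t j * Y j r) - scaleY δ (βf t) Y0 r))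
  refine exists_div_const_of_finite_pattern hC hCc hβf hf0 (fun t => {k | slack t k = 0}) ?_
  intro a b ha hab hpat
  obtain ⟨ha0, ha1, hax, hay⟩ := hl a ha.le
  obtain ⟨-, hb1, -, -⟩ := hl b (ha.trans hab).le
  have hnn : ∀ k, 0 ≤ slack a k := by
    rintro (j | i | r)
    · exact ha0 j
    · exact sub_nonneg.2 (hax i)
    · exact sub_nonneg.2 (hay r)
  have htight : ∀ k, slack a k = 0 → slack b k = 0 := fun k hk =>
    (Set.ext_iff.1 hpat k).1 hk
  obtain ⟨ε, hε, hε0⟩ := ((eventually_forall_nonneg_extend hnn htight).and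
    self_mem_nhdsWithin).exists
  have hsum : ∀ z : Fin n → ℝ, ∑ j, (l a j - ε * (l b j - l a j)) * z j
      = (∑ j, l a j * z j) - ε * ((∑ j, l b j * z j) - ∑ j, l a j * z j) := fun z => by
    simp only [sub_mul, Finset.sum_sub_distrib, Finset.mul_sum, mul_assoc, mul_sub]
  refine ⟨ε, hε0, fun j => l a j - ε * (l b j - l a j), fun j => hε (Sum.inl j), ?_,
    fun i => ?_, fun r => ?_⟩
  · have h := hsum 1
    simp only [Pi.one_apply, mul_one, ha1, hb1] at h
    linarith
  · have h := hε (Sum.inr (Sum.inl i))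
    simp only [slack, Sum.elim_inr, Sum.elim_inl, scaleX] at h
    rw [hsum]
    simp only [scaleX]
    linarith
  · have h := hε (Sum.inr (Sum.inr r))
    simp only [slack, Sum.elim_inr, scaleY] at h
    rw [hsum]
    simp only [scaleY]
    linarith
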